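/- arXiv:1608.03106 — 2 statements merged into one kernel-verified Lean document; each statement's English description precedes it below -/
import Mathlib

section
/- Let B be an abelian category and let 0 → U →(h_1) V →(h_2) W → 0 be a short exact sequence in C_{Z/2}(B), where U has differentials k^0, k^1, V has differentials f^0, f^1, and W has differentials e^0, e^1. If U is acyclic or W is acyclic, then for each i = 0, 1 the induced sequence 0 → Im k^i → Im f^i → Im e^i → 0 (with maps induced by the components of h_1 and h_2) is short exact. -/
open CategoryTheory CategoryTheory.Limits ZeroObject

universe w₁ w₂ w' v u

noncomputable section

/-- The complex shape indexing `ℤ/2`-graded complexes: the differential goes from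
degree `i` to degree `i + 1` (indices taken modulo `2`). -/
abbrev Z2Shape : ComplexShape (ZMod 2) := ComplexShape.up' 1

/-- The abelian category `C_{ℤ/2}(𝒜)` of `ℤ/2`-graded complexes over `𝒜`. -/
abbrev CZ2 (𝒜 : Type u) [Category.{v} 𝒜] [Abelian 𝒜] := HomologicalComplex 𝒜 Z2Shape

variable {𝒜 : Type u} [Category.{v} 𝒜] [Abelian 𝒜]

/-- A `ℤ/2`-graded complex is acyclic if all of its homology objects (`H⁰` and `H¹`) vanish. -/
def AcyclicZ2 {𝒜 : Type u} [Category.{v} 𝒜] [Abelian 𝒜] (M : CZ2 𝒜) : Prop :=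
  ∀ i, IsZero (M.homology i)

/-- `f : X ⟶ Y` and `g : Y ⟶ Z` form a short exact sequence `0 ⟶ X ⟶ Y ⟶ Z ⟶ 0`. -/
def IsShortExactSeq {C : Type*} [Category C] [Limits.HasZeroMorphisms C]
    {X Y Z : C} (f : X ⟶ Y) (g : Y ⟶ Z) : Prop :=
  ∃ w : f ≫ g = 0, (ShortComplex.mk f g w).ShortExact

/-- The map `Im(d_U^i) ⟶ Im(d_V^i)` induced on images by a morphism `h : U ⟶ V`
of `ℤ/2`-graded complexes. -/
def imMap {ℬ : Type u} [Category.{v} ℬ] [Abelian ℬ] {U V : CZ2 ℬ} (h : U ⟶ V) (i : ZMod 2) :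
    image (U.d i (i+1)) ⟶ image (V.d i (i+1)) :=
  image.map (Arrow.homMk (u := h.f i) (v := h.f (i+1)) (h.comm i (i+1)) :
    Arrow.mk (U.d i (i+1)) ⟶ Arrow.mk (V.d i (i+1)))

/-- The map `ker(d_U^i) ⟶ ker(d_V^i)` induced on kernels by a morphism `h : U ⟶ V`
of `ℤ/2`-graded complexes. -/
def kerMap {ℬ : Type u} [Category.{v} ℬ] [Abelian ℬ] {U V : CZ2 ℬ} (h : U ⟶ V) (i : ZMod 2) :
    kernel (U.d i (i+1)) ⟶ kernel (V.d i (i+1)) :=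
  kernel.map (f := U.d i (i+1)) (V.d i (i+1)) (h.f i) (h.f (i+1)) (h.comm i (i+1)).symm

lemma AcyclicZ2.exact_up_to_refinements {ℬ : Type u} [Category.{v} ℬ] [Abelian ℬ] {M : CZ2 ℬ}
    (hM : AcyclicZ2 M) (i : ZMod 2) {A : ℬ} (x : A ⟶ M.X (i + 1))
    (hx : x ≫ M.d (i + 1) (i + 1 + 1) = 0) :
    ∃ (A' : ℬ) (π : A' ⟶ A) (_ : Epi π) (y : A' ⟶ M.X i), π ≫ x = y ≫ M.d i (i + 1) :=
  (M.exactAt_iff_exact_up_to_refinements i (i + 1) (i + 1 + 1)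
    (ComplexShape.prev_eq' _ rfl) (ComplexShape.next_eq' _ rfl)).1
    ((M.exactAt_iff_isZero_homology _).2 (hM (i + 1))) x hx

lemma IsShortExactSeq.degreewise {ℬ : Type u} [Category.{v} ℬ] [Abelian ℬ] {U V W : CZ2 ℬ}
    {f : U ⟶ V} {g : V ⟶ W} (h : IsShortExactSeq f g) (i : ZMod 2) :
    IsShortExactSeq (f.f i) (g.f i) := by
  obtain ⟨w, hw⟩ := h
  exact ⟨by rw [← HomologicalComplex.comp_f, w, HomologicalComplex.zero_f],
    (HomologicalComplex.shortExact_iff_degreewise_shortExact _).1 hw i⟩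

lemma imMap_ι {ℬ : Type u} [Category.{v} ℬ] [Abelian ℬ] {U V : CZ2 ℬ} (h : U ⟶ V) (i : ZMod 2) :
    imMap h i ≫ image.ι (V.d i (i + 1)) = image.ι (U.d i (i + 1)) ≫ h.f (i + 1) :=
  image.map_ι _

lemma factorThruImage_imMap {ℬ : Type u} [Category.{v} ℬ] [Abelian ℬ] {U V : CZ2 ℬ}
    (h : U ⟶ V) (i : ZMod 2) :
    factorThruImage (U.d i (i + 1)) ≫ imMap h i =
      h.f i ≫ factorThruImage (V.d i (i + 1)) :=
  image.factor_map (Arrow.homMk (u := h.f i) (v := h.f (i + 1)) (h.comm i (i + 1)) :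
    Arrow.mk (U.d i (i + 1)) ⟶ Arrow.mk (V.d i (i + 1)))

instance mono_imMap {ℬ : Type u} [Category.{v} ℬ] [Abelian ℬ] {U V : CZ2 ℬ} (h : U ⟶ V)
    (i : ZMod 2) [Mono (h.f (i + 1))] : Mono (imMap h i) :=
  mono_of_mono_fac (imMap_ι h i)

instance epi_imMap {ℬ : Type u} [Category.{v} ℬ] [Abelian ℬ] {U V : CZ2 ℬ} (h : U ⟶ V)
    (i : ZMod 2) [Epi (h.f i)] : Epi (imMap h i) :=
  epi_of_epi_fac (factorThruImage_imMap h i)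

/-- A boundary of the middle complex that vanishes in the quotient comes, up to refinements,
from a boundary of the subcomplex. -/
lemma exists_boundary_lift {ℬ : Type u} [Category.{v} ℬ] [Abelian ℬ]
    {U V W : CZ2 ℬ} {h₁ : U ⟶ V} {h₂ : V ⟶ W} (hS : IsShortExactSeq h₁ h₂)
    (hac : AcyclicZ2 U ∨ AcyclicZ2 W) (i : ZMod 2) {A : ℬ} (v : A ⟶ V.X i)
    (hv : v ≫ V.d i (i + 1) ≫ h₂.f (i + 1) = 0) :
    ∃ (A' : ℬ) (π : A' ⟶ A) (_ : Epi π) (u : A' ⟶ U.X i),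
      π ≫ v ≫ V.d i (i + 1) = u ≫ U.d i (i + 1) ≫ h₁.f (i + 1) := by
  rcases hac with hU | hW
  · obtain ⟨w, hw⟩ := hS.degreewise (i + 1)
    obtain ⟨A₁, π₁, _, u, hu⟩ := hw.exact.exact_up_to_refinements (v ≫ V.d i (i + 1))
      (by simpa using hv)
    dsimp at u hu
    obtain ⟨_, hw'⟩ := hS.degreewise (i + 1 + 1)
    have : Mono (h₁.f (i + 1 + 1)) := hw'.mono_f
    obtain ⟨A₂, π₂, _, u', hu'⟩ := hU.exact_up_to_refinements i u (by
      rw [← cancel_mono (h₁.f (i + 1 + 1)), Category.assoc, ← h₁.comm, ← reassoc_of% hu]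
      simp)
    exact ⟨A₂, π₂ ≫ π₁, inferInstance, u', by
      rw [Category.assoc, hu, reassoc_of% hu']⟩
  · obtain ⟨j, rfl⟩ : ∃ j, i = j + 1 := ⟨i - 1, by ring⟩
    obtain ⟨A₁, π₁, _, w, hw⟩ := hW.exact_up_to_refinements j (v ≫ h₂.f (j + 1))
      (by simpa using hv)
    obtain ⟨_, hj⟩ := hS.degreewise j
    have : Epi (h₂.f j) := hj.epi_g
    obtain ⟨A₂, π₂, _, v', hv'⟩ := surjective_up_to_refinements_of_epi (h₂.f j) w
    obtain ⟨_, hj'⟩ := hS.degreewise (j + 1)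
    obtain ⟨A₃, π₃, _, u, hu⟩ := hj'.exact.exact_up_to_refinements
      (π₂ ≫ π₁ ≫ v - v' ≫ V.d j (j + 1)) (by
        dsimp
        rw [Preadditive.sub_comp, Category.assoc, Category.assoc, hw, reassoc_of% hv',
          Category.assoc, h₂.comm, sub_self])
    dsimp at u hu
    refine ⟨A₃, π₃ ≫ π₂ ≫ π₁, inferInstance, u, ?_⟩
    rw [← h₁.comm, ← reassoc_of% hu]
    simp

/-- for a short exact sequence `0 → U → V → W → 0` of `ℤ/2`-graded
complexes over an abelian category, if `U` or `W` is acyclic then the induced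
sequences `0 → Im k^i → Im f^i → Im e^i → 0` on images are short exact. -/
theorem stmt12 {ℬ : Type u} [Category.{v} ℬ] [Abelian ℬ]
    {U V W : CZ2 ℬ} (h₁ : U ⟶ V) (h₂ : V ⟶ W) (hS : IsShortExactSeq h₁ h₂)
    (hac : AcyclicZ2 U ∨ AcyclicZ2 W) :
    ∀ i : ZMod 2, IsShortExactSeq (imMap h₁ i) (imMap h₂ i) := by
  intro i
  obtain ⟨w, hw⟩ := hS.degreewise (i + 1)
  have : Mono (h₁.f (i + 1)) := hw.mono_f
  have : Epi (h₂.f i) := (hS.degreewise i).2.epi_g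
  have w' : imMap h₁ i ≫ imMap h₂ i = 0 := by
    rw [← cancel_mono (image.ι _), Category.assoc, imMap_ι, reassoc_of% imMap_ι h₁ i,
      w, comp_zero, zero_comp]
  refine ⟨w', { exact := ?_, mono_f := mono_imMap h₁ i, epi_g := epi_imMap h₂ i }⟩
  rw [ShortComplex.exact_iff_exact_up_to_refinements]
  intro A x hx
  dsimp at x hx
  obtain ⟨A₁, π₁, _, v, hv⟩ :=
    surjective_up_to_refinements_of_epi (factorThruImage (V.d i (i + 1))) x
  have hv' : π₁ ≫ x ≫ image.ι _ = v ≫ V.d i (i + 1) := by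
    rw [reassoc_of% hv, image.fac]
  obtain ⟨A₂, π₂, _, u, hu⟩ := exists_boundary_lift hS hac i v (by
    rw [← reassoc_of% hv', ← imMap_ι, reassoc_of% hx, zero_comp, comp_zero])
  refine ⟨A₂, π₂ ≫ π₁, inferInstance, u ≫ factorThruImage _, ?_⟩
  dsimp
  rw [← cancel_mono (image.ι _)]
  simp only [Category.assoc]
  rw [hv', hu, imMap_ι, image.fac_assoc]

end
end

section
/- Let k be a field, let A be an essentially small hereditary abelian k-linear category with finite-dimensional Hom and Ext^1 spaces, and let T be a tilting object of A with associated torsion pair (T, F). Then for every Z/2-graded complex N over A with both components in T there exists a short exact sequence 0 → T_1 →(g_1) T_0 →(g_2) N → 0 in C_{Z/2}(A) such that g_2 is a quasi-isomorphism and both components of T_0 and of T_1 lie in add T (in particular T_1 is acyclic). -/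
open CategoryTheory CategoryTheory.Limits ZeroObject

universe w₁ w₂ w' v u

noncomputable section

variable {𝒜 : Type u} [Category.{v} 𝒜] [Abelian 𝒜]

/-- An abelian category is hereditary if `Ext^p(X, Y) = 0` for all objects `X`, `Y`
and all `p ≥ 2`. -/
def Hereditary (𝒜 : Type u) [Category.{v} 𝒜] [Abelian 𝒜] [HasExt.{w₁} 𝒜] : Prop :=
  ∀ (X Y : 𝒜) (p : ℕ), 2 ≤ p → Subsingleton (Abelian.Ext X Y p)

/-- `X` belongs to `add T`: it is a direct summand of a finite direct sum of copies of `T`. -/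
def InAdd {𝒜 : Type u} [Category.{v} 𝒜] [Abelian 𝒜] (T X : 𝒜) : Prop :=
  haveI : HasFiniteBiproducts 𝒜 := HasFiniteBiproducts.of_hasFiniteProducts
  ∃ (n : ℕ) (Y : 𝒜), Nonempty ((X ⊞ Y) ≅ ⨁ (fun _ : Fin n => T))

/-- `(𝒯, ℱ)` is a torsion pair in the abelian category `𝒜`. -/
structure IsTorsionPair {𝒜 : Type u} [Category.{v} 𝒜] [Abelian 𝒜]
    (𝒯 ℱ : 𝒜 → Prop) : Prop where
  hom_zero : ∀ {X Y : 𝒜}, 𝒯 X → ℱ Y → ∀ f : X ⟶ Y, f = 0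
  decomp : ∀ X : 𝒜, ∃ (TX FX : 𝒜) (i : TX ⟶ X) (p : X ⟶ FX),
      𝒯 TX ∧ ℱ FX ∧ IsShortExactSeq i p

/-- `T` is a tilting object of `𝒜` with associated torsion pair `(𝒯, ℱ)`:
(i) the torsion class `𝒯` cogenerates `𝒜`; (ii) `𝒯 = Fac T`; (iii) `T` is
Ext-projective in `𝒯`; (iv) any `Z ∈ 𝒯` which is Ext-projective in `𝒯` lies in
`add T`; (v) if `Ext^i(T, X) = 0` for all `i ≥ 0` then `X = 0`. -/
structure IsTilting {𝒜 : Type u} [Category.{v} 𝒜] [Abelian 𝒜] [HasExt.{w₁} 𝒜]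
    (T : 𝒜) (𝒯 ℱ : 𝒜 → Prop) : Prop where
  torsionPair : IsTorsionPair 𝒯 ℱ
  cogenerates : ∀ X : 𝒜, ∃ (TX : 𝒜) (f : X ⟶ TX), 𝒯 TX ∧ Mono f
  torsion_eq_fac : ∀ X : 𝒜, 𝒯 X ↔ ∃ (Z : 𝒜) (p : Z ⟶ X), InAdd T Z ∧ Epi p
  ext_vanishing : ∀ X : 𝒜, 𝒯 X → ∀ i : ℕ, 0 < i → Subsingleton (Abelian.Ext T X i)
  ext_projective_in_add : ∀ Z : 𝒜, 𝒯 Z →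
      (∀ X : 𝒜, 𝒯 X → ∀ i : ℕ, 0 < i → Subsingleton (Abelian.Ext Z X i)) → InAdd T Z
  nondegenerate : ∀ X : 𝒜, (∀ i : ℕ, Subsingleton (Abelian.Ext T X i)) → IsZero X

namespace CochainComplex

variable {C : Type u} [Category.{v} C] [Abelian C] {α : Type*} [AddGroup α] [One α]
  (N : CochainComplex C α) {Q : α → C} (p : ∀ i, Q i ⟶ N.X i) (φ : ∀ i, Q i ⟶ Q (i + 1))
  (hφ : ∀ i, φ i ≫ p (i + 1) = p i ≫ N.d i (i + 1))

/-- The map induced on kernels by a degreewise lift of the differential. -/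
def kernelLift (i : α) : kernel (p i) ⟶ kernel (p (i + 1)) :=
  kernel.lift _ (kernel.ι (p i) ≫ φ i) (by
    rw [Category.assoc, hφ, kernel.condition_assoc, zero_comp])

@[simp]
lemma kernelLift_ι (i : α) :
    kernelLift N p φ hφ i ≫ kernel.ι (p (i + 1)) = kernel.ι (p i) ≫ φ i :=
  kernel.lift_ι _ _ _

@[simp]
lemma kernelLift_ι_assoc (i : α) {Z : C} (f : Q (i + 1) ⟶ Z) :
    kernelLift N p φ hφ i ≫ kernel.ι (p (i + 1)) ≫ f = kernel.ι (p i) ≫ φ i ≫ f := by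
  rw [← Category.assoc, kernelLift_ι, Category.assoc]

/-- The square of a degreewise lift of the differential, as a map into the kernel. -/
def squareLift (i : α) : Q i ⟶ kernel (p (i + 1 + 1)) :=
  kernel.lift _ (φ i ≫ φ (i + 1)) (by
    rw [Category.assoc, hφ, ← Category.assoc, hφ, Category.assoc, N.d_comp_d, comp_zero])

@[simp]
lemma squareLift_ι (i : α) :
    squareLift N p φ hφ i ≫ kernel.ι (p (i + 1 + 1)) = φ i ≫ φ (i + 1) :=
  kernel.lift_ι _ _ _

@[simp]
lemma squareLift_ι_assoc (i : α) {Z : C} (f : Q (i + 1 + 1) ⟶ Z) :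
    squareLift N p φ hφ i ≫ kernel.ι (p (i + 1 + 1)) ≫ f = φ i ≫ φ (i + 1) ≫ f := by
  rw [← Category.assoc, squareLift_ι, Category.assoc]

variable [DecidableEq α]

/-- The complex `Qⁱ ⊞ ker pⁱ⁺¹`, whose differential corrects the failure of the lift `φ` of the
differential of `N` to square to zero. -/
def twistedResolution : CochainComplex C α :=
  of (fun i => Q i ⊞ kernel (p (i + 1)))
    (fun i => biprod.desc (biprod.lift (φ i) (-squareLift N p φ hφ i))
      (biprod.lift (kernel.ι (p (i + 1))) (-kernelLift N p φ hφ (i + 1))))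
    (fun i => by ext <;> simp)

/-- The kernel of the projection from the twisted resolution. -/
def twistedKernel : CochainComplex C α :=
  of (fun i => kernel (p i) ⊞ kernel (p (i + 1)))
    (fun i => biprod.desc
      (biprod.lift (kernelLift N p φ hφ i)
        (-(kernelLift N p φ hφ i ≫ kernelLift N p φ hφ (i + 1))))
      (biprod.lift (𝟙 _) (-kernelLift N p φ hφ (i + 1))))
    (fun i => by ext <;> simp)

/-- The projection from the twisted resolution. -/
def twistedResolutionπ : twistedResolution N p φ hφ ⟶ N :=
  ofHom (fun i => biprod.fst ≫ p i) (fun i => by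
    simp only [twistedResolution, of_d]
    ext <;> simp [hφ])

/-- The inclusion of the kernel in the twisted resolution. -/
def twistedKernelι : twistedKernel N p φ hφ ⟶ twistedResolution N p φ hφ :=
  ofHom (fun i => biprod.map (kernel.ι (p i)) (𝟙 _)) (fun i => by
    simp only [twistedResolution, twistedKernel, of_d]
    ext <;> simp)

lemma twistedKernelι_π : twistedKernelι N p φ hφ ≫ twistedResolutionπ N p φ hφ = 0 := by
  ext i
  change biprod.map (kernel.ι (p i)) (𝟙 (kernel (p (i + 1)))) ≫ biprod.fst ≫ p i = 0
  simp

lemma twisted_shortExact [∀ i, Epi (p i)] :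
    (ShortComplex.mk _ _ (twistedKernelι_π N p φ hφ)).ShortExact := by
  refine HomologicalComplex.shortExact_of_degreewise_shortExact _ fun i => ?_
  refine { exact := ?_, mono_f := ?_, epi_g := ?_ }
  · rw [ShortComplex.exact_iff_exact_up_to_refinements]
    intro A (x : A ⟶ Q i ⊞ kernel (p (i + 1))) (hx : x ≫ biprod.fst ≫ p i = 0)
    refine ⟨A, 𝟙 A, inferInstance,
      biprod.lift (kernel.lift (p i) (x ≫ biprod.fst) (by simpa using hx)) (x ≫ biprod.snd), ?_⟩
    change 𝟙 A ≫ x = _ ≫ biprod.map (kernel.ι (p i)) (𝟙 _)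
    ext <;> simp
  · exact inferInstanceAs (Mono (biprod.map (kernel.ι (p i)) (𝟙 (kernel (p (i + 1))))))
  · exact inferInstanceAs (Epi ((biprod.fst : Q i ⊞ kernel (p (i + 1)) ⟶ Q i) ≫ p i))

lemma twistedKernel_acyclic : (twistedKernel N p φ hφ).Acyclic := by
  intro i
  obtain ⟨j, rfl⟩ : ∃ j, j + 1 = i := ⟨i - 1, sub_add_cancel i 1⟩
  rw [HomologicalComplex.exactAt_iff' _ j (j + 1) (j + 1 + 1)
    ((ComplexShape.up α).prev_eq' rfl) ((ComplexShape.up α).next_eq' rfl),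
    ShortComplex.exact_iff_exact_up_to_refinements]
  intro A (x : A ⟶ kernel (p (j + 1)) ⊞ kernel (p (j + 1 + 1))) hx
  change x ≫ (twistedKernel N p φ hφ).d _ _ = 0 at hx
  refine ⟨A, 𝟙 A, inferInstance, x ≫ biprod.fst ≫ biprod.inr, ?_⟩
  change 𝟙 A ≫ x = _ ≫ (twistedKernel N p φ hφ).d _ _
  simp only [twistedKernel, of_d] at hx ⊢
  have hx₁ := hx =≫ biprod.fst
  have h : biprod.desc
      (biprod.lift (kernelLift N p φ hφ (j + 1))
        (-(kernelLift N p φ hφ (j + 1) ≫ kernelLift N p φ hφ (j + 1 + 1))))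
      (biprod.lift (𝟙 _) (-kernelLift N p φ hφ (j + 1 + 1))) ≫ biprod.fst =
      biprod.fst ≫ kernelLift N p φ hφ (j + 1) + biprod.snd := by
    ext <;> simp
  rw [Category.assoc] at hx₁
  erw [h, zero_comp, Preadditive.comp_add] at hx₁
  have e : x = x ≫ biprod.fst ≫ biprod.lift (𝟙 _) (-kernelLift N p φ hφ (j + 1)) := by
    apply biprod.hom_ext
    · simp
    · simpa using eq_neg_of_add_eq_zero_right hx₁
  rw [Category.id_comp]
  refine e.trans ?_
  erw [Category.assoc, Category.assoc, biprod.inr_desc]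

end CochainComplex

namespace HomologicalComplex

lemma quasiIso_g_of_acyclic {C : Type*} [Category* C] [Abelian C] {ι : Type*} {c : ComplexShape ι}
    {S : ShortComplex (HomologicalComplex C c)} (hS : S.ShortExact) (h : S.X₁.Acyclic)
    (hc : ∀ i, ∃ j, c.Rel i j) : QuasiIso S.g where
  quasiIsoAt i := by
    obtain ⟨j, hij⟩ := hc i
    rw [quasiIsoAt_iff_isIso_homologyMap]
    have : Mono (homologyMap S.g i) :=
      (hS.homology_exact₂ i).mono_g ((h i).isZero_homology.eq_of_src _ _)
    have : Epi (homologyMap S.g i) :=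
      (hS.homology_exact₃ i j hij).epi_f ((h j).isZero_homology.eq_of_tgt _ _)
    exact isIso_of_mono_of_epi _

end HomologicalComplex

namespace IsTorsionPair

lemma torsion_of_hom_zero {𝒯 ℱ : 𝒜 → Prop} (h : IsTorsionPair 𝒯 ℱ)
    (hiso : ∀ {X Y : 𝒜}, (X ≅ Y) → 𝒯 X → 𝒯 Y) {X : 𝒜}
    (hX : ∀ F, ℱ F → ∀ f : X ⟶ F, f = 0) : 𝒯 X := by
  obtain ⟨TX, FX, i, p, hTX, hFX, w, hS⟩ := h.decomp X
  have := hS.mono_f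
  have : Epi i := hS.exact.epi_f (hX FX hFX p)
  have := isIso_of_mono_of_epi i
  exact hiso (asIso i) hTX

end IsTorsionPair

namespace IsTilting

attribute [local instance] Abelian.hasFiniteBiproducts

lemma inAdd_biproduct (T : 𝒜) (n : ℕ) : InAdd T (⨁ fun _ : Fin n => T) :=
  ⟨n, 0, ⟨(isoBiprodZero (isZero_zero 𝒜)).symm⟩⟩

lemma exists_universal_map (k : Type*) [Field k] [CategoryTheory.Linear k 𝒜] (T X : 𝒜)
    [FiniteDimensional k (T ⟶ X)] :
    ∃ (n : ℕ) (p : (⨁ fun _ : Fin n => T) ⟶ X), ∀ f : T ⟶ X, ∃ g, g ≫ p = f := by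
  let b := Module.finBasis k (T ⟶ X)
  refine ⟨_, biproduct.desc b, fun f => ⟨biproduct.lift fun i => b.repr f i • 𝟙 T, ?_⟩⟩
  rw [biproduct.lift_desc]
  simp [Linear.smul_comp, b.sum_repr f]

lemma exists_lift_biproduct {T X Q : 𝒜} {p : Q ⟶ X} (hp : ∀ f : T ⟶ X, ∃ g, g ≫ p = f) {n : ℕ}
    (f : (⨁ fun _ : Fin n => T) ⟶ X) : ∃ g, g ≫ p = f := by
  choose g hg using fun i => hp (biproduct.ι (fun _ : Fin n => T) i ≫ f)
  exact ⟨biproduct.desc g, by ext i; simp [hg]⟩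

variable [HasExt.{w₁} 𝒜] {T : 𝒜} {𝒯 ℱ : 𝒜 → Prop}

lemma torsion_of_iso (hT : IsTilting T 𝒯 ℱ) {X Y : 𝒜} (e : X ≅ Y) (hX : 𝒯 X) : 𝒯 Y := by
  obtain ⟨Z, p, hZ, _⟩ := (hT.torsion_eq_fac X).1 hX
  exact (hT.torsion_eq_fac Y).2 ⟨Z, p ≫ e.hom, hZ, inferInstance⟩

lemma torsion_of_hom_zero (hT : IsTilting T 𝒯 ℱ) {X : 𝒜}
    (hX : ∀ F, ℱ F → ∀ f : X ⟶ F, f = 0) : 𝒯 X :=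
  hT.torsionPair.torsion_of_hom_zero hT.torsion_of_iso hX

/-- An object of the torsion class that is Ext-projective with respect to it. -/
def ExtProjective (𝒯 : 𝒜 → Prop) (Z : 𝒜) : Prop :=
  𝒯 Z ∧ ∀ X : 𝒜, 𝒯 X → ∀ i : ℕ, 0 < i → Subsingleton (Abelian.Ext Z X i)

lemma ExtProjective.inAdd (hT : IsTilting T 𝒯 ℱ) {Z : 𝒜} (hZ : ExtProjective 𝒯 Z) : InAdd T Z :=
  hT.ext_projective_in_add Z hZ.1 hZ.2

lemma extProjective_biprod (hT : IsTilting T 𝒯 ℱ) {X Y : 𝒜} (hX : ExtProjective 𝒯 X)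
    (hY : ExtProjective 𝒯 Y) : ExtProjective 𝒯 (X ⊞ Y) := by
  refine ⟨hT.torsion_of_hom_zero fun F hF f => ?_, fun Z hZ i hi => ?_⟩
  · ext
    · simpa using hT.torsionPair.hom_zero hX.1 hF _
    · simpa using hT.torsionPair.hom_zero hY.1 hF _
  · have := hX.2 Z hZ i hi
    have := hY.2 Z hZ i hi
    exact Abelian.Ext.biprodAddEquiv.subsingleton

lemma torsion_of_inAdd (hT : IsTilting T 𝒯 ℱ) {X : 𝒜} (hX : InAdd T X) : 𝒯 X :=
  (hT.torsion_eq_fac X).2 ⟨X, 𝟙 X, hX, inferInstance⟩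

lemma extProjective_biproduct (hT : IsTilting T 𝒯 ℱ) (n : ℕ) :
    ExtProjective 𝒯 (⨁ fun _ : Fin n => T) := by
  refine ⟨hT.torsion_of_inAdd (inAdd_biproduct T n), fun X hX i hi => ?_⟩
  have := hT.ext_vanishing X hX i hi
  exact (Abelian.Ext.biproductAddEquiv (biproduct.isBilimit fun _ : Fin n => T) X i).subsingleton

lemma torsion_self (hT : IsTilting T 𝒯 ℱ) : 𝒯 T :=
  hT.torsion_of_hom_zero fun F hF f => by
    have h := hT.torsionPair.hom_zero (hT.extProjective_biproduct 1).1 hF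
      (biproduct.π (fun _ : Fin 1 => T) 0 ≫ f)
    simpa using biproduct.ι (fun _ : Fin 1 => T) 0 ≫= h

lemma torsion_of_ext_eq_zero (hT : IsTilting T 𝒯 ℱ) (h𝒜 : Hereditary 𝒜) {X : 𝒜}
    (hX : Subsingleton (Abelian.Ext T X 1)) : 𝒯 X := by
  obtain ⟨TX, FX, i, p, hTX, hFX, w, hS⟩ := hT.torsionPair.decomp X
  have := hS.mono_f
  have hF : IsZero FX := hT.nondegenerate FX fun n => by
    match n with
    | 0 =>
      have : Subsingleton (T ⟶ FX) := subsingleton_of_forall_eq 0 fun f =>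
        hT.torsionPair.hom_zero hT.torsion_self hFX f
      exact Abelian.Ext.homEquiv₀.subsingleton
    | 1 =>
      refine subsingleton_of_forall_eq 0 fun x => ?_
      obtain ⟨y, rfl⟩ := Abelian.Ext.covariant_sequence_exact₃ T hS x (one_add_one_eq_two)
        ((h𝒜 _ _ 2 le_rfl).elim _ _)
      rw [Subsingleton.elim y 0, Abelian.Ext.zero_comp]
    | n + 2 => exact h𝒜 _ _ _ (by lia)
  have : Epi i := hS.exact.epi_f (hF.eq_of_tgt _ _)
  have := isIso_of_mono_of_epi i
  exact hT.torsion_of_iso (asIso i) hTX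

lemma extProjective_of_shortExact (h𝒜 : Hereditary 𝒜) {S : ShortComplex 𝒜} (hS : S.ShortExact)
    (h₁ : 𝒯 S.X₁) (h₂ : ExtProjective 𝒯 S.X₂) : ExtProjective 𝒯 S.X₁ := by
  refine ⟨h₁, fun X hX i hi => subsingleton_of_forall_eq 0 fun x => ?_⟩
  have := h₂.2 X hX i hi
  obtain ⟨y, rfl⟩ := Abelian.Ext.contravariant_sequence_exact₁ hS X x rfl
    ((h𝒜 _ _ (1 + i) (by lia)).elim _ _)
  rw [Subsingleton.elim y 0, Abelian.Ext.comp_zero]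

lemma epi_of_lift (hT : IsTilting T 𝒯 ℱ) {X Q : 𝒜} (hX : 𝒯 X) {p : Q ⟶ X}
    (hp : ∀ f : T ⟶ X, ∃ g, g ≫ p = f) : Epi p := by
  obtain ⟨Z, q, ⟨n, Y, ⟨e⟩⟩, _⟩ := (hT.torsion_eq_fac X).1 hX
  obtain ⟨g, hg⟩ := exists_lift_biproduct hp (e.inv ≫ biprod.fst ≫ q)
  exact epi_of_epi_fac hg

lemma extProjective_kernel (hT : IsTilting T 𝒯 ℱ) (h𝒜 : Hereditary 𝒜) {X Q : 𝒜}
    (hQ : ExtProjective 𝒯 Q) (p : Q ⟶ X) [Epi p] (hp : ∀ f : T ⟶ X, ∃ g, g ≫ p = f) :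
    ExtProjective 𝒯 (kernel p) := by
  have hS : (ShortComplex.mk _ _ (kernel.condition p)).ShortExact :=
    { exact := ShortComplex.exact_kernel p }
  refine extProjective_of_shortExact h𝒜 hS (hT.torsion_of_ext_eq_zero h𝒜 ?_) hQ
  refine subsingleton_of_forall_eq 0 fun x => ?_
  obtain ⟨y, rfl⟩ := Abelian.Ext.covariant_sequence_exact₁ T hS x
    ((hT.ext_vanishing Q hQ.1 1 one_pos).elim _ _) (zero_add 1)
  obtain ⟨f, rfl⟩ := Abelian.Ext.homEquiv₀.symm.surjective y
  obtain ⟨g, rfl⟩ := hp f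
  change (Abelian.Ext.mk₀ (g ≫ p)).comp _ _ = 0
  rw [← Abelian.Ext.mk₀_comp_mk₀, Abelian.Ext.comp_assoc_of_second_deg_zero]
  erw [hS.comp_extClass]
  rw [Abelian.Ext.comp_zero]

end IsTilting

/-- if `T` is a tilting object in a hereditary abelian category with torsion
pair `(𝒯, ℱ)`, every `ℤ/2`-graded complex `N` with both components in `𝒯` admits a short
exact sequence `0 → T₁ → T₀ → N → 0` in `C_{ℤ/2}(𝒜)` with `T₀ → N` a quasi-isomorphism
and both components of `T₀` and `T₁` in `add T` (in particular `T₁` is acyclic). -/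
theorem stmt18 (k : Type w') [Field k] {𝒜 : Type u} [Category.{v} 𝒜] [Abelian 𝒜]
    [CategoryTheory.Linear k 𝒜] [EssentiallySmall.{w₂} 𝒜] [HasExt.{w₁} 𝒜]
    [∀ X Y : 𝒜, FiniteDimensional k (X ⟶ Y)]
    (hExtFin : ∀ X Y : 𝒜, ∃ n : ℕ, Nonempty (Abelian.Ext X Y 1 ≃+ (Fin n → k)))
    (h𝒜 : Hereditary 𝒜) (T : 𝒜) {𝒯 ℱ : 𝒜 → Prop} (hT : IsTilting T 𝒯 ℱ) :
    ∀ N : CZ2 𝒜, (∀ i, 𝒯 (N.X i)) →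
      ∃ (T₁ T₀ : CZ2 𝒜) (g₁ : T₁ ⟶ T₀) (g₂ : T₀ ⟶ N),
        IsShortExactSeq g₁ g₂ ∧ QuasiIso g₂ ∧
        (∀ i, InAdd T (T₀.X i)) ∧ (∀ i, InAdd T (T₁.X i)) ∧ AcyclicZ2 T₁ := by
  intro N hN
  choose n p hp using fun i => IsTilting.exists_universal_map k T (N.X i)
  have hepi i : Epi (p i) := hT.epi_of_lift (hN i) (hp i)
  choose φ hφ using fun i =>
    IsTilting.exists_lift_biproduct (hp (i + 1)) (p i ≫ N.d i (i + 1))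
  have hQ i := hT.extProjective_biproduct (n i)
  have hL i := hT.extProjective_kernel h𝒜 (hQ i) (p i) (hp i)
  have hS := CochainComplex.twisted_shortExact N p φ hφ
  have hac := CochainComplex.twistedKernel_acyclic N p φ hφ
  exact ⟨_, _, _, _, ⟨_, hS⟩,
    HomologicalComplex.quasiIso_g_of_acyclic hS hac fun i => ⟨i + 1, rfl⟩,
    fun i => (hT.extProjective_biprod (hQ i) (hL (i + 1))).inAdd hT,
    fun i => (hT.extProjective_biprod (hL i) (hL (i + 1))).inAdd hT,
    fun i => (hac i).isZero_homology⟩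

end
end
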